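/- arXiv:2203.09256 — 2 statements merged into one kernel-verified Lean document; each statement's English description precedes it below -/
import Mathlib

section
/- If G is a chordal graph that is not a complete graph, then b(G) ≤ ω(G). -/
open SimpleGraph

section Defs
variable {V : Type*}

/-- `S` is a dominating set of `G`. -/
def Dominates (G : SimpleGraph V) (S : Set V) : Prop :=
  ∀ v : V, v ∈ S ∨ ∃ u ∈ S, G.Adj u v

/-- The domination number `γ(G)`. -/
noncomputable def domNum (G : SimpleGraph V) [Fintype V] : ℕ :=
  sInf {n | ∃ S : Finset V, S.card = n ∧ Dominates G ↑S}

/-- The bondage number `b(G)`. -/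
noncomputable def bondageNum (G : SimpleGraph V) [Fintype V] : ℕ :=
  sInf {n | ∃ A : Finset (Sym2 V), ↑A ⊆ G.edgeSet ∧ A.card = n ∧
    domNum (G.deleteEdges ↑A) = domNum G + 1}

/-- The clique number `ω(G)`. -/
noncomputable def cliqueNum' (G : SimpleGraph V) [Fintype V] : ℕ :=
  sSup {n | ∃ s : Finset V, G.IsNClique n s}

/-- The degree of a vertex. -/
noncomputable def vdeg (G : SimpleGraph V) (v : V) : ℕ := (G.neighborSet v).ncard

/-- The maximum degree `Δ(G)`. -/
noncomputable def maxDeg (G : SimpleGraph V) [Fintype V] : ℕ :=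
  sSup {d | ∃ v, vdeg G v = d}

/-- A chordal graph: no induced cycle of length at least 4. -/
def Chordal (G : SimpleGraph V) : Prop :=
  ∀ n, 4 ≤ n → IsEmpty (cycleGraph n ↪g G)

/-- The corona `G ∘ K₁`: attach a pendant vertex to each vertex of `G`. -/
def coronaK1 (G : SimpleGraph V) : SimpleGraph (V ⊕ V) :=
  SimpleGraph.fromRel (fun a b =>
    (∃ u v, a = Sum.inl u ∧ b = Sum.inl v ∧ G.Adj u v) ∨
    (∃ u, a = Sum.inl u ∧ b = Sum.inr u))

end Defs

section Helpers
variable {V : Type*}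

/-- Graph `G` with only the edges inside `U`. -/
def resGraph (G : SimpleGraph V) (U : Set V) : SimpleGraph V where
  Adj x y := G.Adj x y ∧ x ∈ U ∧ y ∈ U
  symm := ⟨fun _ _ h => ⟨h.1.symm, h.2.2, h.2.1⟩⟩
  loopless := ⟨fun _ h => G.loopless.irrefl _ h.1⟩

/-- No induced cycle through `v`. -/
lemma no_hole (G : SimpleGraph V) (hch : Chordal G) (v a b : V) (U : Set V)
    (hU : ∀ x ∈ U, x = a ∨ x = b ∨ (x ≠ v ∧ ¬ G.Adj v x))
    (ha : G.Adj v a) (hb : G.Adj v b) (hab : a ≠ b)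
    (hr : (resGraph G U).Reachable a b) : G.Adj a b := by
  by_contra hnab
  obtain ⟨H, hH⟩ : ∃ H, H = resGraph G U := ⟨_, rfl⟩
  rw [← hH] at hr
  obtain ⟨p, hp⟩ := hr.exists_walk_length_eq_dist
  obtain ⟨k, hk⟩ : ∃ k, k = H.dist a b := ⟨_, rfl⟩
  rw [← hk] at hp
  have hHG : ∀ x y, H.Adj x y → G.Adj x y ∧ x ∈ U ∧ y ∈ U := by
    subst hH; exact fun x y h => h
  have htri : ∀ x y z, H.Reachable x y → H.Reachable y z →
      H.dist x z ≤ H.dist x y + H.dist y z := by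
    intro x y z h1 h2
    obtain ⟨p1, hp1⟩ := h1.exists_walk_length_eq_dist
    obtain ⟨p2, hp2⟩ := h2.exists_walk_length_eq_dist
    have := SimpleGraph.dist_le (p1.append p2)
    rw [Walk.length_append] at this
    omega
  have hdist : ∀ i ≤ k, H.dist a (p.getVert i) = i := by
    intro i hi
    have h1 := SimpleGraph.dist_le (p.take i)
    have h2 := SimpleGraph.dist_le (p.drop i)
    have h3 := htri a (p.getVert i) b ⟨p.take i⟩ ⟨p.drop i⟩
    rw [Walk.take_length] at h1
    rw [Walk.drop_length] at h2
    omega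
  have hstep : ∀ i < k, H.Adj (p.getVert i) (p.getVert (i+1)) := by
    intro i hi
    exact p.adj_getVert_succ (by omega)
  have hk2 : 2 ≤ k := by
    rcases Nat.lt_or_ge k 2 with h | h
    · exfalso
      have h0 : p.getVert 0 = a := p.getVert_zero
      have h1 : p.getVert k = b := by rw [← hp]; exact p.getVert_length
      interval_cases k
      · exact hab (h0.symm.trans h1)
      · have := hstep 0 (by omega)
        simp only [Nat.zero_add] at this
        rw [h0, h1] at this
        exact hnab (hHG _ _ this).1
    · exact h
  have h0 : p.getVert 0 = a := p.getVert_zero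
  have h1 : p.getVert k = b := by rw [← hp]; exact p.getVert_length
  have hmem : ∀ i ≤ k, p.getVert i ∈ U := by
    intro i hi
    rcases Nat.lt_or_ge i k with h | h
    · exact (hHG _ _ (hstep i h)).2.1
    · have := (hHG _ _ (hstep (k-1) (by omega))).2.2
      have e : k - 1 + 1 = i := by omega
      rwa [e] at this
  have hinj : ∀ i ≤ k, ∀ j ≤ k, p.getVert i = p.getVert j → i = j := by
    intro i hi j hj h
    rw [← hdist i hi, ← hdist j hj, h]
  have hint : ∀ i, 0 < i → i < k → p.getVert i ≠ v ∧ ¬ G.Adj v (p.getVert i) := by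
    intro i hi hik
    rcases hU _ (hmem i hik.le) with h | h | h
    · have := hinj i hik.le 0 (by omega) (h.trans h0.symm); omega
    · have := hinj i hik.le k le_rfl (h.trans h1.symm); omega
    · exact h
  have hnv : ∀ i ≤ k, p.getVert i ≠ v := by
    intro i hi
    rcases Nat.eq_zero_or_pos i with h | h
    · subst h; rw [h0]; exact ha.ne'
    · rcases Nat.lt_or_ge i k with h' | h'
      · exact (hint i h h').1
      · have : i = k := by omega
        rw [this, h1]; exact hb.ne'
  have hva : ∀ i ≤ k, (G.Adj v (p.getVert i) ↔ i = 0 ∨ i = k) := by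
    intro i hi
    constructor
    · intro h
      by_contra hc
      exact (hint i (by omega) (by omega)).2 h
    · rintro (rfl | rfl)
      · rw [h0]; exact ha
      · rw [h1]; exact hb
  have hadj : ∀ i ≤ k, ∀ j ≤ k,
      (G.Adj (p.getVert i) (p.getVert j) ↔ i + 1 = j ∨ j + 1 = i) := by
    intro i hi j hj
    constructor
    · intro h
      have hh : H.Adj (p.getVert i) (p.getVert j) := by
        subst hH; exact ⟨h, hmem i hi, hmem j hj⟩
      have e1 := htri a _ _ ⟨p.take i⟩ hh.reachable
      have e2 := htri a _ _ ⟨p.take j⟩ hh.symm.reachable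
      rw [hdist i hi, hdist j hj, SimpleGraph.dist_eq_one_iff_adj.2 hh] at e1
      rw [hdist i hi, hdist j hj, SimpleGraph.dist_eq_one_iff_adj.2 hh.symm] at e2
      have : i ≠ j := by rintro rfl; exact G.loopless.irrefl _ h
      omega
    · rintro (rfl | rfl)
      · exact (hHG _ _ (hstep i (by omega))).1
      · exact (hHG _ _ (hstep j (by omega))).1.symm
  refine (hch (k+2) (by omega)).false ⟨⟨fun i => if i.val ≤ k then p.getVert i.val else v, ?_⟩, ?_⟩
  · intro i j hij
    have := i.isLt
    have := j.isLt
    ext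
    by_cases h : i.val ≤ k <;> by_cases h' : j.val ≤ k <;> simp only [h, h', if_true, if_false] at hij
    · exact hinj _ h _ h' hij
    · exact absurd hij (hnv _ h)
    · exact absurd hij.symm (hnv _ h')
    · omega
  · intro i j
    have hi := i.isLt
    have hj := j.isLt
    have hc : (cycleGraph (k+2)).Adj i j ↔ (i.val + 1 = j.val ∨ j.val + 1 = i.val ∨
        (i.val = 0 ∧ j.val = k+1) ∨ (j.val = 0 ∧ i.val = k+1)) := by
      rw [cycleGraph_adj']
      rw [Fin.sub_def, Fin.sub_def]
      simp only
      have m1 : ∀ x y : ℕ, x < k + 2 → y < k + 2 → ((k + 2 - x + y) % (k+2) = 1 ↔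
          (x + 1 = y ∨ (y = 0 ∧ x = k + 1))) := by
        intro x y hx hy
        rcases Nat.lt_or_ge y x with h | h
        · rw [Nat.mod_eq_of_lt (by omega)]; omega
        · have : k + 2 - x + y = (y - x) + (k+2) := by omega
          rw [this, Nat.add_mod_right, Nat.mod_eq_of_lt (by omega)]; omega
      rw [m1 _ _ hj hi, m1 _ _ hi hj]
      omega
    rw [hc]
    change G.Adj (if i.val ≤ k then p.getVert i.val else v) (if j.val ≤ k then p.getVert j.val else v) ↔ _
    by_cases h : i.val ≤ k <;> by_cases h' : j.val ≤ k <;> simp only [h, h', if_true, if_false]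
    · rw [hadj _ h _ h']; omega
    · rw [G.adj_comm, hva _ h]; omega
    · rw [hva _ h']; omega
    · simp only [SimpleGraph.irrefl, false_iff]; omega

lemma dirac [Fintype V] (G : SimpleGraph V) (hch : Chordal G) :
    ∀ (n : ℕ) (W : Finset V), W.card = n → ∀ v ∈ W, ∀ w ∈ W, w ≠ v → ¬ G.Adj v w →
      ∃ u ∈ W, u ≠ v ∧ ¬ G.Adj v u ∧
        ∀ a ∈ W, ∀ b ∈ W, G.Adj u a → G.Adj u b → a ≠ b → G.Adj a b := by
  classical
  intro n
  induction n using Nat.strong_induction_on with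
  | _ n ih =>
  intro W hW v hv w hw hwv hvw
  let R : Set V := {x | x ∈ W ∧ x ≠ v ∧ ¬ G.Adj v x}
  let C : Set V := {x | x ∈ R ∧ (resGraph G R).Reachable w x}
  let N : Set V := {x | x ∈ W ∧ G.Adj v x ∧ ∃ c ∈ C, G.Adj x c}
  have hwC : w ∈ C := ⟨⟨hw, hwv, hvw⟩, Reachable.refl _⟩
  have hN : ∀ a ∈ N, ∀ b ∈ N, a ≠ b → G.Adj a b := by
    rintro a ⟨haW, hva, c, hc, hac⟩ b ⟨hbW, hvb, d, hd, hbd⟩ hab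
    refine no_hole G hch v a b (R ∪ {a, b}) ?_ hva hvb hab ?_
    · rintro x (hx | hx | hx)
      · exact Or.inr (Or.inr hx.2)
      · exact Or.inl hx
      · exact Or.inr (Or.inl hx)
    · have hle : resGraph G R ≤ resGraph G (R ∪ {a, b}) := by
        intro x y h
        exact ⟨h.1, Or.inl h.2.1, Or.inl h.2.2⟩
      have h1 : (resGraph G (R ∪ {a, b})).Adj a c := ⟨hac, by simp, Or.inl hc.1⟩
      have h2 : (resGraph G (R ∪ {a, b})).Adj d b := ⟨hbd.symm, Or.inl hd.1, by simp⟩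
      exact h1.reachable.trans (((hc.2.symm.trans hd.2).mono hle).trans h2.reachable)
  have hcl : ∀ c ∈ C, ∀ x ∈ W, G.Adj c x → x ∈ C ∨ x ∈ N := by
    intro c hc x hx hcx
    by_cases h : G.Adj v x
    · exact Or.inr ⟨hx, h, c, hc, hcx.symm⟩
    · have hxv : x ≠ v := by
        rintro rfl
        exact hc.1.2.2 hcx.symm
      have hxR : x ∈ R := ⟨hx, hxv, h⟩
      have : (resGraph G R).Adj c x := ⟨hcx, hc.1, hxR⟩
      exact Or.inl ⟨hxR, hc.2.trans this.reachable⟩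
  let W' : Finset V := W.filter (fun x => x ∈ C ∨ x ∈ N)
  have hW' : ∀ x, x ∈ W' ↔ (x ∈ C ∨ x ∈ N) := by
    intro x
    simp only [W', Finset.mem_filter, and_iff_right_iff_imp]
    rintro (h | h)
    · exact h.1.1
    · exact h.1
  have hlt : W'.card < n := by
    rw [← hW]
    apply Finset.card_lt_card
    refine ⟨Finset.filter_subset _ _, fun h => ?_⟩
    rcases (hW' v).1 (h hv) with h | h
    · exact h.1.2.1 rfl
    · exact G.loopless.irrefl _ h.2.1
  -- it suffices to find a vertex of `C` that is simplicial in `W'`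
  have hsuff : (∃ u ∈ C, ∀ a ∈ W', ∀ b ∈ W', G.Adj u a → G.Adj u b → a ≠ b → G.Adj a b) →
      ∃ u ∈ W, u ≠ v ∧ ¬ G.Adj v u ∧
        ∀ a ∈ W, ∀ b ∈ W, G.Adj u a → G.Adj u b → a ≠ b → G.Adj a b := by
    rintro ⟨u, hu, h⟩
    exact ⟨u, hu.1.1, hu.1.2.1, hu.1.2.2, fun a ha b hb hua hub hab =>
      h a ((hW' a).2 (hcl u hu a ha hua)) b ((hW' b).2 (hcl u hu b hb hub)) hua hub hab⟩
  apply hsuff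
  by_cases hnu : ∃ x ∈ N, ∃ y ∈ W', y ≠ x ∧ ¬ G.Adj x y
  · obtain ⟨x, hx, y, hy, hyx, hxy⟩ := hnu
    obtain ⟨u, hu, hux, hnux, h⟩ := ih _ hlt W' rfl x ((hW' x).2 (Or.inr hx)) y hy hyx hxy
    refine ⟨u, ?_, h⟩
    rcases (hW' u).1 hu with h' | h'
    · exact h'
    · exact absurd (hN x hx u h' hux.symm) hnux
  · by_cases hcu : ∃ x ∈ C, ∃ y ∈ W', y ≠ x ∧ ¬ G.Adj x y
    · obtain ⟨x, hx, y, hy, hyx, hxy⟩ := hcu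
      obtain ⟨u, hu, hux, hnux, h⟩ := ih _ hlt W' rfl x ((hW' x).2 (Or.inl hx)) y hy hyx hxy
      refine ⟨u, ?_, h⟩
      rcases (hW' u).1 hu with h' | h'
      · exact h'
      · exact absurd ⟨u, h', x, (hW' x).2 (Or.inl hx), hux.symm, fun hh => hnux hh.symm⟩ hnu
    · push Not at hnu hcu
      refine ⟨w, hwC, ?_⟩
      intro a ha b hb _ _ hab
      rcases (hW' a).1 ha with h | h
      · exact hcu a h b hb hab.symm
      · exact hnu a h b hb hab.symm

lemma exists_simplicial [Fintype V] (G : SimpleGraph V) (hch : Chordal G) (W : Finset V)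
    (hne : W.Nonempty) : ∃ u ∈ W,
      ∀ a ∈ W, ∀ b ∈ W, G.Adj u a → G.Adj u b → a ≠ b → G.Adj a b := by
  by_cases h : ∃ v ∈ W, ∃ w ∈ W, w ≠ v ∧ ¬ G.Adj v w
  · obtain ⟨v, hv, w, hw, h1, h2⟩ := h
    obtain ⟨u, hu, _, _, h⟩ := dirac G hch _ W rfl v hv w hw h1 h2
    exact ⟨u, hu, h⟩
  · push Not at h
    obtain ⟨u, hu⟩ := hne
    exact ⟨u, hu, fun a ha b hb _ _ hab => h a ha b hb hab.symm⟩

lemma domNum_le [Fintype V] (G : SimpleGraph V) (S : Finset V) (h : Dominates G ↑S) :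
    domNum G ≤ S.card := Nat.sInf_le ⟨S, rfl, h⟩

lemma exists_dom [Fintype V] (G : SimpleGraph V) :
    ∃ S : Finset V, S.card = domNum G ∧ Dominates G ↑S := by
  have : domNum G ∈ {n | ∃ S : Finset V, S.card = n ∧ Dominates G ↑S} :=
    Nat.sInf_mem ⟨_, Finset.univ, rfl, fun v => Or.inl (by simp)⟩
  exact this

lemma domNum_delete_one [Fintype V] (G G' : SimpleGraph V) (u w : V)
    (h : ∀ x y, G.Adj x y → s(x, y) ≠ s(u, w) → G'.Adj x y) :
    domNum G' ≤ domNum G + 1 := by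
  classical
  obtain ⟨S, hS, hd⟩ := exists_dom G
  let z := if u ∈ S then w else u
  have : Dominates G' ↑(insert z S) := by
    intro x
    rcases hd x with hx | ⟨y, hy, hyx⟩
    · left; simp at hx; simp [hx]
    · by_cases he : s(y, x) = s(u, w)
      · left
        simp only [Finset.mem_coe] at hy
        rcases Sym2.eq_iff.1 he with ⟨rfl, rfl⟩ | ⟨rfl, rfl⟩
        · simp [z, hy]
        · by_cases hc : x ∈ S <;> simp [z, hc]
      · right
        exact ⟨y, by simp at hy; simp [hy], h _ _ hyx he⟩
  have h1 := domNum_le G' _ this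
  have h2 := Finset.card_insert_le z S
  omega

lemma bondage_le [Fintype V] (G : SimpleGraph V) (A : Finset (Sym2 V)) (hA : ↑A ⊆ G.edgeSet)
    (h : domNum G < domNum (G.deleteEdges ↑A)) : bondageNum G ≤ A.card := by
  classical
  induction A using Finset.induction_on with
  | empty => simp at h
  | insert e A he ih =>
    have hA' : (A : Set (Sym2 V)) ⊆ G.edgeSet := fun x hx => hA (by simp at hx; simp [hx])
    by_cases hc : domNum G < domNum (G.deleteEdges ↑A)
    · exact (ih hA' hc).trans (Finset.card_le_card (Finset.subset_insert _ _))
    · refine Nat.sInf_le ⟨insert e A, hA, rfl, ?_⟩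
      induction e with
      | _ u w =>
      have := domNum_delete_one (G.deleteEdges ↑A) (G.deleteEdges ↑(insert s(u, w) A)) u w (by
        intro x y hxy hne
        simp only [deleteEdges_adj, Finset.coe_insert, Set.mem_insert_iff, not_or] at hxy ⊢
        exact ⟨hxy.1, hne, hxy.2⟩)
      omega

lemma card_le_cliqueNum' [Fintype V] (G : SimpleGraph V) (B : Finset V) (h : G.IsClique ↑B) :
    B.card ≤ cliqueNum' G := by
  refine le_csSup ⟨Fintype.card V, ?_⟩ ⟨B, h, rfl⟩
  rintro n ⟨s, hs⟩
  rw [← hs.card_eq]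
  exact Finset.card_le_univ s

lemma key [Fintype V] (G : SimpleGraph V) (s t : V) (hst : s ≠ t)
    (hB : ∀ a b, a ≠ s → b ≠ s → (G.Adj s a ∨ G.Adj t a) → (G.Adj s b ∨ G.Adj t b) →
      a ≠ b → G.Adj a b)
    (h : G.Adj s t ∨ ∃ x, G.Adj s x ∧ G.Adj t x ∧ ∀ y, G.Adj t y → y ≠ x → G.Adj x y) :
    bondageNum G ≤ cliqueNum' G := by
  classical
  let B : Finset V := Finset.univ.filter (fun a => a ≠ s ∧ (G.Adj s a ∨ G.Adj t a))
  let f : V → Sym2 V := fun b => if G.Adj s b then s(s, b) else s(t, b)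
  have hBc : G.IsClique ↑B := by
    intro a ha b hb hab
    simp only [B, Finset.coe_filter, Finset.mem_univ, true_and, Set.mem_ofPred_eq] at ha hb
    exact hB a b ha.1 hb.1 ha.2 hb.2 hab
  refine le_trans ?_ (card_le_cliqueNum' G B hBc)
  refine le_trans ?_ (Finset.card_image_le (s := B) (f := f))
  have hs : ∀ b, G.Adj s b → s(s, b) ∈ B.image f := by
    intro b hb
    refine Finset.mem_image.2 ⟨b, ?_, by simp [f, hb]⟩
    simp [B, hb, hb.ne']
  have ht : ∀ b, G.Adj t b → b ≠ s → ¬ G.Adj s b → s(t, b) ∈ B.image f := by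
    intro b hb hbs hn
    refine Finset.mem_image.2 ⟨b, ?_, by simp [f, hn]⟩
    simp [B, hb, hbs]
  apply bondage_le
  · intro e he
    obtain ⟨b, hb, rfl⟩ := Finset.mem_image.1 (Finset.mem_coe.1 he)
    simp only [B, Finset.mem_filter, Finset.mem_univ, true_and] at hb
    by_cases hc : G.Adj s b
    · simp [f, hc]
    · simpa [f, hc] using hb.2
  · generalize B.image f = A at hs ht
    obtain ⟨D, hD, hdom⟩ := exists_dom (G.deleteEdges ↑A)
    have hadj : ∀ x y, (G.deleteEdges ↑A).Adj x y → G.Adj x y ∧ s(x, y) ∉ A := by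
      intro x y hxy
      simpa using hxy
    rw [← hD]
    have hns : ∀ y, ¬ (G.deleteEdges ↑A).Adj s y := fun y hy =>
      (hadj _ _ hy).2 (hs _ (hadj _ _ hy).1)
    have hsD : s ∈ D := by
      rcases hdom s with h | ⟨u, _, hu⟩
      · exact h
      · exact absurd hu.symm (hns _)
    have hcardE : (D.erase s).card + 1 = D.card := Finset.card_erase_add_one hsD
    have case1 : (∃ u ∈ D, u ≠ s ∧ G.Adj u s) → domNum G < D.card := by
      rintro ⟨u, hu, hus, hadju⟩
      have : Dominates G ↑(D.erase s) := by
        intro v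
        by_cases hv : v = s
        · subst hv
          exact Or.inr ⟨u, by simp [hu, hus], hadju⟩
        · rcases hdom v with h | ⟨y, hy, hyv⟩
          · exact Or.inl (by simp at h; simp [h, hv])
          · have : y ≠ s := by rintro rfl; exact hns _ hyv
            exact Or.inr ⟨y, by simp at hy; simp [hy, this], (hadj _ _ hyv).1⟩
      have := domNum_le G _ this
      omega
    have htd : (∃ u ∈ D, u ≠ s ∧ G.Adj u s) ∨ t ∈ D := by
      rcases hdom t with h | ⟨u, hu, hut⟩
      · exact Or.inr h
      · have hus : u ≠ s := by rintro rfl; exact hns _ hut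
        left
        refine ⟨u, hu, hus, ?_⟩
        by_contra hc
        exact (hadj _ _ hut.symm).2 (ht u (hadj _ _ hut.symm).1 hus (fun h => hc h.symm))
    rcases htd with h' | htD
    · exact case1 h'
    rcases h with h | ⟨x, hsx, htx, hx⟩
    · exact case1 ⟨t, htD, hst.symm, h.symm⟩
    · have : Dominates G ↑(insert x ((D.erase s).erase t)) := by
        intro v
        by_cases hvx : v = x
        · left; simp [hvx]
        by_cases hvs : v = s
        · right; exact ⟨x, by simp, hvs ▸ hsx.symm⟩
        by_cases hvt : v = t
        · right; exact ⟨x, by simp, hvt ▸ htx.symm⟩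
        rcases hdom v with h | ⟨y, hy, hyv⟩
        · left; simp at h; simp [h, hvs, hvt]
        · right
          have hys : y ≠ s := by rintro rfl; exact hns _ hyv
          by_cases hyt : y = t
          · subst hyt
            exact ⟨x, by simp, hx v (hadj _ _ hyv).1 hvx⟩
          · exact ⟨y, by simp at hy; simp [hy, hys, hyt], (hadj _ _ hyv).1⟩
      have h1 := domNum_le G _ this
      have h2 := Finset.card_insert_le x ((D.erase s).erase t)
      have h3 : ((D.erase s).erase t).card + 1 = (D.erase s).card :=
        Finset.card_erase_add_one (by simp [htD, hst.symm])
      omega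

end Helpers

/-- a chordal non-complete graph satisfies `b(G) ≤ ω(G)`. -/
theorem bondage_chordal_le_cliqueNum (V : Type*) [Fintype V] (G : SimpleGraph V)
    (hch : Chordal G) (hnc : G ≠ ⊤) :
    bondageNum G ≤ cliqueNum' G := by
  classical
  by_cases hE : ∃ u w, G.Adj u w
  swap
  · have : bondageNum G = 0 := by
      apply Nat.sInf_eq_zero.2
      right
      ext n
      simp only [Set.mem_ofPred_eq, Set.mem_empty_iff_false, iff_false]
      rintro ⟨A, hA, _, h⟩
      have hA0 : A = ∅ := by
        apply Finset.eq_empty_of_forall_notMem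
        intro e he
        have := hA he
        induction e with
        | _ u w => exact hE ⟨u, w, this⟩
      subst hA0
      simp at h
    omega
  let Simp : V → Prop := fun v => ∀ a b, G.Adj v a → G.Adj v b → a ≠ b → G.Adj a b
  by_cases htw : ∃ s t, G.Adj s t ∧ Simp s ∧ Simp t
  · obtain ⟨s, t, hst, hs, ht⟩ := htw
    refine key G s t hst.ne ?_ (Or.inl hst)
    have hmem : ∀ a, a ≠ s → (G.Adj s a ∨ G.Adj t a) → G.Adj s a := by
      rintro a has (h | h)
      · exact h
      · exact ht s a hst.symm h has.symm
    intro a b ha hb h1 h2 hab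
    exact hs a b (hmem a ha h1) (hmem b hb h2) hab
  · have htw' : ∀ s a, Simp s → G.Adj s a → ¬ Simp a := fun s a h1 h2 h3 => htw ⟨s, a, h2, h1, h3⟩
    let W : Finset V := Finset.univ.filter (fun v => ¬ Simp v)
    have hW : ∀ v, v ∈ W ↔ ¬ Simp v := by simp [W]
    have hWne : W.Nonempty := by
      obtain ⟨u, w, huw⟩ := hE
      by_cases h : Simp u
      · exact ⟨w, (hW w).2 (htw' u w h huw)⟩
      · exact ⟨u, (hW u).2 h⟩
    obtain ⟨x, hxW, hx⟩ := exists_simplicial G hch W hWne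
    have hxn := (hW x).1 hxW
    have hclq : ∀ a b, a ∈ W → b ∈ W → (a = x ∨ G.Adj x a) → (b = x ∨ G.Adj x b) → a ≠ b →
        G.Adj a b := by
      rintro a b ha hb (rfl | h1) (rfl | h2) hab
      · exact absurd rfl hab
      · exact h2
      · exact h1.symm
      · exact hx a ha b hb h1 h2 hab
    have hex : ∃ s, G.Adj x s ∧ Simp s := by
      by_contra hc
      push Not at hc
      exact hxn fun a b ha hb hab => hx a ((hW a).2 (hc a ha)) b ((hW b).2 (hc b hb)) ha hb hab
    obtain ⟨s, hxs, hs⟩ := hex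
    have hsn : ∀ s, G.Adj x s → Simp s → ∀ a, G.Adj s a → a ∈ W ∧ (a = x ∨ G.Adj x a) := by
      intro s hxs hs a ha
      refine ⟨(hW a).2 (htw' s a hs ha), ?_⟩
      by_cases hax : a = x
      · exact Or.inl hax
      · exact Or.inr (hs x a hxs.symm ha (Ne.symm hax))
    by_cases ht : ∃ t, t ≠ s ∧ G.Adj x t ∧ Simp t
    · obtain ⟨t, hts, hxt, ht⟩ := ht
      refine key G s t hts.symm ?_ (Or.inr ⟨x, hxs.symm, hxt.symm, ?_⟩)
      · intro a b _ _ h1 h2 hab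
        have ha := h1.elim (hsn s hxs hs a) (hsn t hxt ht a)
        have hb := h2.elim (hsn s hxs hs b) (hsn t hxt ht b)
        exact hclq a b ha.1 hb.1 ha.2 hb.2 hab
      · intro y hy hyx
        exact ht x y hxt.symm hy hyx.symm
    · push Not at ht
      refine key G s x hxs.ne' ?_ (Or.inl hxs.symm)
      intro a b ha hb h1 h2 hab
      have hh : ∀ a, a ≠ s → (G.Adj s a ∨ G.Adj x a) → a ∈ W ∧ (a = x ∨ G.Adj x a) := by
        rintro a ha (h | h)
        · exact hsn s hxs hs a h
        · exact ⟨(hW a).2 (ht a ha h), Or.inr h⟩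
      have ha := hh a ha h1
      have hb := hh b hb h2
      exact hclq a b ha.1 hb.1 ha.2 hb.2 hab
end

section
/- For the corona G = K_n ∘ K_1 with n ≥ 2, the bondage number b(G) equals n = ω(G), showing that the bound b(G) ≤ ω(G) for chordal non-complete graphs is sharp. -/
open SimpleGraph

theorem domNum_le_aux {V : Type*} [Fintype V] (G : SimpleGraph V) (S : Finset V)
    (h : Dominates G ↑S) : domNum G ≤ S.card :=
  Nat.sInf_le ⟨S, rfl, h⟩

theorem le_domNum_aux {V : Type*} [Fintype V] (G : SimpleGraph V) (k : ℕ)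
    (h : ∀ S : Finset V, Dominates G ↑S → k ≤ S.card) : k ≤ domNum G := by
  have hne : {n | ∃ S : Finset V, S.card = n ∧ Dominates G ↑S}.Nonempty :=
    ⟨_, Finset.univ, rfl, fun v => Or.inl (by simp)⟩
  obtain ⟨S, hS, hd⟩ := Nat.sInf_mem hne
  have := h S hd
  unfold domNum
  omega

abbrev Cor (n : ℕ) : SimpleGraph (Fin n ⊕ Fin n) := coronaK1 (⊤ : SimpleGraph (Fin n))

theorem cor_ll {n : ℕ} (i j : Fin n) : (Cor n).Adj (Sum.inl i) (Sum.inl j) ↔ i ≠ j := by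
  simp [Cor, coronaK1]
  grind

theorem cor_lr {n : ℕ} (i j : Fin n) : (Cor n).Adj (Sum.inl i) (Sum.inr j) ↔ i = j := by
  simp [Cor, coronaK1]
  exact eq_comm

theorem cor_rl {n : ℕ} (i j : Fin n) : (Cor n).Adj (Sum.inr i) (Sum.inl j) ↔ i = j := by
  rw [SimpleGraph.adj_comm, cor_lr, eq_comm]

theorem cor_rr {n : ℕ} (i j : Fin n) : ¬ (Cor n).Adj (Sum.inr i) (Sum.inr j) := by
  simp [Cor, coronaK1]

theorem domNum_cor (n : ℕ) : domNum (Cor n) = n := by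
  apply le_antisymm
  · have := domNum_le_aux (Cor n) (Finset.univ.image Sum.inl) (by
      rintro (i | i)
      · left; simp
      · right; exact ⟨Sum.inl i, by simp, (cor_lr i i).2 rfl⟩)
    rwa [Finset.card_image_of_injective _ Sum.inl_injective, Finset.card_fin] at this
  · apply le_domNum_aux
    intro S hS
    have : (Finset.univ : Finset (Fin n)) ⊆ S.image (Sum.elim id id) := by
      intro i _
      rw [Finset.mem_image]
      rcases hS (Sum.inr i) with h | ⟨u, hu, ha⟩
      · exact ⟨_, h, rfl⟩
      · rcases u with u | u
        · exact ⟨_, hu, (cor_lr u i).1 ha⟩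
        · exact absurd ha (cor_rr u i)
    have := (Finset.card_le_card this).trans Finset.card_image_le
    simpa using this

theorem lower_cor (n : ℕ) (A : Finset (Sym2 (Fin n ⊕ Fin n))) (hA : A.card < n) :
    domNum ((Cor n).deleteEdges ↑A) ≤ n := by
  classical
  let f : Fin n → Fin n ⊕ Fin n := fun i =>
    if s(Sum.inl i, Sum.inr i) ∈ A then Sum.inr i else Sum.inl i
  refine (domNum_le_aux _ (Finset.univ.image f) ?_).trans
    (Finset.card_image_le.trans (by simp))
  have hf : ∀ i, f i ∈ (↑(Finset.univ.image f) : Set (Fin n ⊕ Fin n)) := fun i => by simp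
  rintro (i | i)
  · by_cases hi : s(Sum.inl i, Sum.inr i) ∈ A
    · right
      by_contra hcon
      let g : Fin n → Sym2 (Fin n ⊕ Fin n) := fun j =>
        if s(Sum.inl j, Sum.inr j) ∈ A then s(Sum.inl j, Sum.inr j) else s(Sum.inl i, Sum.inl j)
      have hg : ∀ j ∈ (Finset.univ : Finset (Fin n)), g j ∈ A := by
        intro j _
        by_cases hj : s(Sum.inl j, Sum.inr j) ∈ A
        · simp [g, hj]
        · by_contra hgj
          simp only [g, hj, if_false] at hgj
          refine hcon ⟨Sum.inl j, ?_, ?_⟩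
          · have := hf j
            simpa only [f, hj, if_false] using this
          · rw [SimpleGraph.deleteEdges_adj, cor_ll]
            refine ⟨fun h => hj (h ▸ hi), ?_⟩
            rw [Sym2.eq_swap]
            exact_mod_cast hgj
      have hinj : Function.Injective g := by
        intro a b hab
        simp only [g] at hab
        split_ifs at hab with h1 h2 h2 <;> simp at hab <;> grind
      have := Finset.card_le_card_of_injOn g hg hinj.injOn
      simp at this
      omega
    · left
      have := hf i
      simpa only [f, hi, if_false] using this
  · by_cases hi : s(Sum.inl i, Sum.inr i) ∈ A
    · left
      have := hf i
      simpa only [f, hi, if_true] using this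
    · right
      refine ⟨Sum.inl i, ?_, ?_⟩
      · have := hf i
        simpa only [f, hi, if_false] using this
      · rw [SimpleGraph.deleteEdges_adj, cor_lr]
        exact ⟨rfl, by exact_mod_cast hi⟩

theorem upper_cor (n : ℕ) (hn : 2 ≤ n) :
    ∃ A : Finset (Sym2 (Fin n ⊕ Fin n)), ↑A ⊆ (Cor n).edgeSet ∧ A.card = n ∧
      domNum ((Cor n).deleteEdges ↑A) = domNum (Cor n) + 1 := by
  classical
  let z : Fin n := ⟨0, by omega⟩
  let p : Fin n → Sym2 (Fin n ⊕ Fin n) := fun i => s(Sum.inl i, Sum.inr i)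
  have hp : Function.Injective p := by
    intro a b h
    simpa [p] using h
  refine ⟨Finset.univ.image p, ?_, ?_, ?_⟩
  · intro e he
    simp only [Finset.coe_image, Finset.coe_univ, Set.image_univ, Set.mem_range] at he
    obtain ⟨i, rfl⟩ := he
    exact (cor_lr i i).2 rfl
  · rw [Finset.card_image_of_injective _ hp, Finset.card_fin]
  · rw [domNum_cor]
    apply le_antisymm
    · refine (domNum_le_aux _ (insert (Sum.inl z) (Finset.univ.image Sum.inr)) ?_).trans
        ((Finset.card_insert_le _ _).trans
          (Nat.succ_le_succ (Finset.card_image_le.trans (by simp))))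
      rintro (i | i)
      · by_cases h : i = z
        · left; simp [h]
        · right
          refine ⟨Sum.inl z, by simp, ?_⟩
          rw [SimpleGraph.deleteEdges_adj, cor_ll]
          exact ⟨fun h' => h h'.symm, by simp [p]⟩
      · left; simp
    · apply le_domNum_aux
      intro S hS
      have hr : ∀ i, Sum.inr i ∈ S := by
        intro i
        rcases hS (Sum.inr i) with h | ⟨u, hu, ha⟩
        · exact h
        · rw [SimpleGraph.deleteEdges_adj] at ha
          rcases u with u | u
          · obtain rfl := (cor_lr u i).1 ha.1
            exact absurd (by simp [p]) ha.2
          · exact absurd ha.1 (cor_rr u i)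
      have hl : ∃ j, Sum.inl j ∈ S := by
        rcases hS (Sum.inl z) with h | ⟨u, hu, ha⟩
        · exact ⟨_, h⟩
        · rw [SimpleGraph.deleteEdges_adj] at ha
          rcases u with u | u
          · exact ⟨u, hu⟩
          · obtain rfl := (cor_rl u z).1 ha.1
            exact absurd (by simp [p]) ha.2
      obtain ⟨j, hj⟩ := hl
      have hsub : insert (Sum.inl j) (Finset.univ.image Sum.inr) ⊆ S := by
        intro x hx
        simp only [Finset.mem_insert, Finset.mem_image, Finset.mem_univ, true_and] at hx
        rcases hx with rfl | ⟨i, rfl⟩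
        · exact hj
        · exact hr i
      have := Finset.card_le_card hsub
      rwa [Finset.card_insert_of_notMem (by simp),
        Finset.card_image_of_injective _ Sum.inr_injective, Finset.card_fin] at this

theorem clique_cor (n : ℕ) (hn : 2 ≤ n) : n = cliqueNum' (Cor n) := by
  classical
  symm
  refine IsGreatest.csSup_eq ⟨⟨Finset.univ.image Sum.inl, ?_, ?_⟩, ?_⟩
  · intro a ha b hb hab
    simp only [Finset.coe_image, Finset.coe_univ, Set.image_univ, Set.mem_range] at ha hb
    obtain ⟨i, rfl⟩ := ha
    obtain ⟨j, rfl⟩ := hb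
    exact (cor_ll i j).2 (fun h => hab (h ▸ rfl))
  · rw [Finset.card_image_of_injective _ Sum.inl_injective, Finset.card_fin]
  · rintro k ⟨s, hs, rfl⟩
    by_cases h : ∃ i, Sum.inr i ∈ s
    · obtain ⟨i, hi⟩ := h
      have hsub : s ⊆ {Sum.inl i, Sum.inr i} := by
        intro x hx
        by_cases hxi : x = Sum.inr i
        · simp [hxi]
        · have ha := hs hx hi hxi
          rcases x with x | x
          · simp [(cor_lr x i).1 ha]
          · exact absurd ha (cor_rr x i)
      exact ((Finset.card_le_card hsub).trans Finset.card_le_two).trans hn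
    · have hsub : s ⊆ Finset.univ.image Sum.inl := by
        rintro (x | x) hx
        · simp
        · exact absurd ⟨x, hx⟩ h
      exact ((Finset.card_le_card hsub).trans Finset.card_image_le).trans (by simp)

/-- `b(K_n ∘ K₁) = n = ω(K_n ∘ K₁)` for `n ≥ 2`. -/
theorem bondage_corona_complete (n : ℕ) (hn : 2 ≤ n) :
    bondageNum (coronaK1 (⊤ : SimpleGraph (Fin n))) = n ∧
    n = cliqueNum' (coronaK1 (⊤ : SimpleGraph (Fin n))) := by
  refine ⟨?_, clique_cor n hn⟩
  refine IsLeast.csInf_eq ⟨upper_cor n hn, ?_⟩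
  rintro k ⟨A, -, rfl, hd⟩
  by_contra hlt
  have h1 := lower_cor n A (by omega)
  have h2 := domNum_cor n
  simp only [Cor] at h1 h2
  omega
end
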